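/- Consider the physical fractional Brownian motion model with Hurst parameter H ∈ (0,1), noise intensity σ > 0, scale-separation parameter ε > 0 and fixed horizon T > 0. Let 0 < α < min{H/(1/2+H), H/(3/2−H)} and couple the sampling rate by δ = ε^α. Then, as ε → 0⁺ (along values of ε for which N = T/δ is a positive integer), the rescaled estimation error (σ̂²_{ε,δ} − σ²)/√δ converges in distribution to a centered Gaussian random variable with variance 2σ⁴/T. -/

import Mathlib

open MeasureTheory ProbabilityTheory Filter Matrix Topology

noncomputable section

/-- Covariance function of two-sided fractional Brownian motion with Hurst parameter `H`. -/
def fbmCov (H s t : ℝ) : ℝ :=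
  (|s| ^ (2 * H) + |t| ^ (2 * H) - |s - t| ^ (2 * H)) / 2

/-- `B` is a two-sided fractional Brownian motion with Hurst parameter `H`:
a.s. continuous paths, `B 0 = 0`, and all finite-dimensional marginals are centered
Gaussian with covariance `fbmCov H`. -/
structure IsTwoSidedFBM {Ω : Type*} [MeasureSpace Ω] (H : ℝ) (B : ℝ → Ω → ℝ) : Prop where
  meas : ∀ t, Measurable (B t)
  cont : ∀ᵐ ω : Ω, Continuous fun t => B t ω
  zero : ∀ᵐ ω : Ω, B 0 ω = 0
  gaussian : ∀ (n : ℕ) (t a : Fin n → ℝ),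
    Measure.map (fun ω => ∑ i, a i * B (t i) ω) (ℙ : Measure Ω)
      = gaussianReal 0 (∑ i, ∑ j, a i * a j * fbmCov H (t i) (t j)).toNNReal

/-- The stationary fractional Ornstein–Uhlenbeck process
`Y^ε_t = (σ/ε^H)(B^H_t − (1/ε)∫_{−∞}^t e^{−(t−s)/ε} B^H_s ds)`. -/
def fracOU {Ω : Type*} [MeasureSpace Ω] (H σ ε : ℝ) (B : ℝ → Ω → ℝ) (t : ℝ) (ω : Ω) : ℝ :=
  (σ / ε ^ H) * (B t ω - (1 / ε) * ∫ s in Set.Iic t, Real.exp (-(t - s) / ε) * B s ω)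

/-- The slow component `X^ε_t = ε^{H−1} ∫_0^t Y^ε_s ds` of the physical fractional
Brownian motion model. -/
def slowX {Ω : Type*} [MeasureSpace Ω] (H σ ε : ℝ) (B : ℝ → Ω → ℝ) (t : ℝ) (ω : Ω) : ℝ :=
  ε ^ (H - 1) * ∫ s in (0 : ℝ)..t, fracOU H σ ε B s ω

/-- Covariance matrix of the increments, over a grid of mesh `δ`, of fractional Brownian
motion with Hurst parameter `H`. -/
def SigmaH (H δ : ℝ) (N : ℕ) : Matrix (Fin N) (Fin N) ℝ := fun i j =>
  δ ^ (2 * H) / 2 *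
    (|(i : ℝ) - (j : ℝ) + 1| ^ (2 * H) + |(i : ℝ) - (j : ℝ) - 1| ^ (2 * H)
      - 2 * |(i : ℝ) - (j : ℝ)| ^ (2 * H))

/-- Vector of increments of the slow component over the grid of mesh `δ`. -/
def incVec {Ω : Type*} [MeasureSpace Ω] (H σ ε δ : ℝ) (B : ℝ → Ω → ℝ) (N : ℕ) (ω : Ω) :
    Fin N → ℝ := fun k =>
  slowX H σ ε B (((k : ℕ) + 1 : ℝ) * δ) ω - slowX H σ ε B ((k : ℕ) * δ) ω

/-- The maximum-likelihood-type estimator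
`σ̂²_{ε,δ} = (1/N) Vᵀ (Σ^H_{δ,N})⁻¹ V`. -/
def sigmaHat2 {Ω : Type*} [MeasureSpace Ω] (H σ ε δ : ℝ) (B : ℝ → Ω → ℝ) (N : ℕ) (ω : Ω) : ℝ :=
  (1 / (N : ℝ)) * (incVec H σ ε δ B N ω ⬝ᵥ ((SigmaH H δ N)⁻¹ *ᵥ incVec H σ ε δ B N ω))

lemma integrableOn_one_sub_cos_mul_rpow {H : ℝ} (h0 : 0 < H) (h1 : H < 1) :
    IntegrableOn (fun x : ℝ => (1 - Real.cos x) * x ^ (-1 - 2 * H)) (Set.Ioi 0) := by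
  have hmeas : Measurable fun x : ℝ => (1 - Real.cos x) * x ^ (-1 - 2 * H) := by fun_prop
  rw [← Set.Ioc_union_Ioi_eq_Ioi zero_le_one]
  refine IntegrableOn.union ?_ ?_
  · have hi : IntegrableOn (fun x : ℝ => x ^ (1 - 2 * H)) (Set.Ioc 0 1) :=
      (intervalIntegrable_iff_integrableOn_Ioc_of_le zero_le_one).1
        (intervalIntegral.intervalIntegrable_rpow' (by linarith))
    refine Integrable.mono' hi hmeas.aestronglyMeasurable ?_
    filter_upwards [ae_restrict_mem measurableSet_Ioc] with x hx
    have hx0 : 0 < x := hx.1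
    rw [Real.norm_of_nonneg (mul_nonneg (by linarith [Real.cos_le_one x]) (by positivity))]
    have h2 : x ^ (1 - 2 * H) = x ^ 2 * x ^ (-1 - 2 * H) := by
      rw [← Real.rpow_natCast, ← Real.rpow_add hx0]; congr 1; push_cast; ring
    rw [h2]
    gcongr
    nlinarith [Real.one_sub_sq_div_two_le_cos (x := x)]
  · have hi : IntegrableOn (fun x : ℝ => 2 * x ^ (-1 - 2 * H)) (Set.Ioi 1) :=
      (integrableOn_Ioi_rpow_of_lt (by linarith) one_pos).const_mul 2
    refine Integrable.mono' hi hmeas.aestronglyMeasurable ?_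
    filter_upwards [ae_restrict_mem measurableSet_Ioi] with x hx
    have hx0 : 0 < x := lt_trans one_pos hx
    rw [Real.norm_of_nonneg (mul_nonneg (by linarith [Real.cos_le_one x]) (by positivity))]
    gcongr
    linarith [Real.neg_one_le_cos x]

/-- The constant `∫₀^∞ (1 - cos x) x^(-1-2H) dx` in the spectral representation of `|t|^(2H)`. -/
def spectralConst (H : ℝ) : ℝ := ∫ x in Set.Ioi (0 : ℝ), (1 - Real.cos x) * x ^ (-1 - 2 * H)

lemma spectralConst_pos {H : ℝ} (h0 : 0 < H) (h1 : H < 1) : 0 < spectralConst H := by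
  unfold spectralConst
  have hi := integrableOn_one_sub_cos_mul_rpow h0 h1
  have hnn : ∀ x ∈ Set.Ioi (0 : ℝ), 0 ≤ (1 - Real.cos x) * x ^ (-1 - 2 * H) := fun x hx =>
    mul_nonneg (by linarith [Real.cos_le_one x]) (Real.rpow_nonneg (le_of_lt hx) _)
  have hsub : Set.Ioo (0 : ℝ) 1 ⊆ Set.Ioi 0 := fun x hx => hx.1
  refine lt_of_lt_of_le ?_ (setIntegral_mono_set hi
    ((ae_restrict_mem measurableSet_Ioi).mono hnn) hsub.eventuallyLE)
  rw [setIntegral_pos_iff_support_of_nonneg_ae]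
  · have : Set.Ioo (0 : ℝ) 1 ⊆
        (Function.support fun x : ℝ => (1 - Real.cos x) * x ^ (-1 - 2 * H)) ∩ Set.Ioo 0 1 := by
      intro x hx
      refine ⟨?_, hx⟩
      have hc : Real.cos x < 1 := by
        rw [← Real.cos_zero]
        exact Real.cos_lt_cos_of_nonneg_of_le_pi le_rfl
          (by linarith [hx.2, Real.pi_gt_three]) hx.1
      exact (mul_pos (by linarith) (Real.rpow_pos_of_pos hx.1 _)).ne'
    exact lt_of_lt_of_le (by simp) (measure_mono this)
  · exact (ae_restrict_mem measurableSet_Ioo).mono fun x hx => hnn x hx.1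
  · exact hi.mono_set hsub

lemma integral_one_sub_cos_mul {H : ℝ} (h0 : 0 < H) (h1 : H < 1) (t : ℝ) :
    IntegrableOn (fun x : ℝ => (1 - Real.cos (t * x)) * x ^ (-1 - 2 * H)) (Set.Ioi 0) ∧
    ∫ x in Set.Ioi (0 : ℝ), (1 - Real.cos (t * x)) * x ^ (-1 - 2 * H)
      = spectralConst H * |t| ^ (2 * H) := by
  rcases eq_or_ne t 0 with rfl | ht
  · have : 2 * H ≠ 0 := by positivity
    simp [Real.zero_rpow this]
  have hp : 0 < |t| := abs_pos.2 ht
  have heq : ∀ x ∈ Set.Ioi (0 : ℝ), (1 - Real.cos (t * x)) * x ^ (-1 - 2 * H)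
      = |t| ^ (1 + 2 * H) * ((1 - Real.cos (|t| * x)) * (|t| * x) ^ (-1 - 2 * H)) := by
    intro x hx
    have hc : Real.cos (t * x) = Real.cos (|t| * x) := by
      rcases abs_choice t with h | h <;> simp [h]
    rw [Real.mul_rpow hp.le (le_of_lt hx), hc]
    have : |t| ^ (1 + 2 * H) * |t| ^ (-1 - 2 * H) = 1 := by
      rw [← Real.rpow_add hp]; ring_nf; simp
    linear_combination (-(1 - Real.cos (|t| * x)) * x ^ (-1 - 2 * H)) * this
  constructor
  · rw [integrableOn_congr_fun heq measurableSet_Ioi]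
    have := (integrableOn_Ioi_comp_mul_left_iff
      (fun x : ℝ => (1 - Real.cos x) * x ^ (-1 - 2 * H)) 0 hp).2
      (by simpa using integrableOn_one_sub_cos_mul_rpow h0 h1)
    exact this.const_mul _
  · rw [setIntegral_congr_fun measurableSet_Ioi heq, integral_const_mul,
      integral_comp_mul_left_Ioi (fun x : ℝ => (1 - Real.cos x) * x ^ (-1 - 2 * H)) 0 hp]
    simp only [mul_zero, smul_eq_mul]
    rw [show (1 + 2 * H) = 2 * H + 1 by ring, Real.rpow_add hp, Real.rpow_one, spectralConst]
    field_simp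

lemma integral_cos_mul_one_sub_cos {H : ℝ} (h0 : 0 < H) (h1 : H < 1) (d : ℝ) :
    IntegrableOn (fun x : ℝ => Real.cos (d * x) * ((1 - Real.cos x) * x ^ (-1 - 2 * H)))
      (Set.Ioi 0) ∧
    ∫ x in Set.Ioi (0 : ℝ), Real.cos (d * x) * ((1 - Real.cos x) * x ^ (-1 - 2 * H))
      = spectralConst H *
        ((|d + 1| ^ (2 * H) + |d - 1| ^ (2 * H) - 2 * |d| ^ (2 * H)) / 2) := by
  obtain ⟨i1, e1⟩ := integral_one_sub_cos_mul h0 h1 (d + 1)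
  obtain ⟨i2, e2⟩ := integral_one_sub_cos_mul h0 h1 (d - 1)
  obtain ⟨i3, e3⟩ := integral_one_sub_cos_mul h0 h1 d
  have heq : (fun x : ℝ => Real.cos (d * x) * ((1 - Real.cos x) * x ^ (-1 - 2 * H)))
      = fun x => (1 / 2 : ℝ) * (((1 - Real.cos ((d + 1) * x)) * x ^ (-1 - 2 * H)
        + (1 - Real.cos ((d - 1) * x)) * x ^ (-1 - 2 * H))
        - 2 * ((1 - Real.cos (d * x)) * x ^ (-1 - 2 * H))) := by
    funext x
    rw [add_mul d, sub_mul d, one_mul, Real.cos_add, Real.cos_sub]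
    ring
  have i12 := i1.add i2
  simp only [Pi.add_def] at i12
  rw [heq]
  refine ⟨((i1.add i2).sub (i3.const_mul 2)).const_mul _, ?_⟩
  rw [integral_const_mul, integral_sub i12 (i3.const_mul 2),
    integral_add i1 i2, integral_const_mul, e1, e2, e3]
  ring

lemma sum_mul_cos_sub {N : ℕ} (v : Fin N → ℝ) (x : ℝ) :
    ∑ i, ∑ j, v i * v j * Real.cos (((i : ℝ) - (j : ℝ)) * x)
      = (∑ i, v i * Real.cos (i * x)) ^ 2 + (∑ i, v i * Real.sin (i * x)) ^ 2 := by
  rw [sq, sq, Finset.sum_mul_sum, Finset.sum_mul_sum, ← Finset.sum_add_distrib]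
  refine Finset.sum_congr rfl fun i _ => ?_
  rw [← Finset.sum_add_distrib]
  refine Finset.sum_congr rfl fun j _ => ?_
  rw [sub_mul, Real.cos_sub]
  ring

lemma sum_mul_cos_sub_le {N : ℕ} (v : Fin N → ℝ) (x : ℝ) :
    ∑ i, ∑ j, v i * v j * Real.cos (((i : ℝ) - (j : ℝ)) * x) ≤ N * (v ⬝ᵥ v) := by
  rw [sum_mul_cos_sub]
  have h1 := Finset.sum_mul_sq_le_sq_mul_sq Finset.univ v fun i : Fin N => Real.cos (i * x)
  have h2 := Finset.sum_mul_sq_le_sq_mul_sq Finset.univ v fun i : Fin N => Real.sin (i * x)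
  have h3 : ∑ i : Fin N, Real.cos (i * x) ^ 2 + ∑ i : Fin N, Real.sin (i * x) ^ 2 = N := by
    rw [← Finset.sum_add_distrib]; simp
  have h4 : v ⬝ᵥ v = ∑ i, v i ^ 2 := by simp [dotProduct, sq]
  rw [h4, ← h3]
  linarith

lemma integral_sum_mul_cos_sub {N : ℕ} (v : Fin N → ℝ) :
    ∫ x in (0 : ℝ)..Real.pi, ∑ i, ∑ j, v i * v j * Real.cos (((i : ℝ) - (j : ℝ)) * x)
      = Real.pi * (v ⬝ᵥ v) := by
  have hcos : ∀ i j : Fin N, ∫ x in (0 : ℝ)..Real.pi, Real.cos (((i : ℝ) - (j : ℝ)) * x)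
      = if i = j then Real.pi else 0 := by
    intro i j
    split_ifs with h
    · simp [h]
    · have hd : ((i : ℝ) - (j : ℝ)) ≠ 0 := by
        rw [sub_ne_zero]; exact_mod_cast fun h' => h (Fin.ext h')
      rw [intervalIntegral.integral_comp_mul_left (fun x => Real.cos x) hd, integral_cos]
      have : Real.sin (((i : ℝ) - (j : ℝ)) * Real.pi) = 0 := by
        have := Real.sin_int_mul_pi ((i : ℤ) - (j : ℤ))
        push_cast at this; exact this
      simp [this]
  have hii : ∀ i j : Fin N, IntervalIntegrable
      (fun x : ℝ => v i * v j * Real.cos (((i : ℝ) - (j : ℝ)) * x)) volume 0 Real.pi :=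
    fun i j => Continuous.intervalIntegrable (by fun_prop) _ _
  rw [intervalIntegral.integral_finsetSum
    (fun i _ => Continuous.intervalIntegrable (by fun_prop) _ _)]
  have hrow : ∀ i : Fin N, ∫ x in (0 : ℝ)..Real.pi,
      ∑ j, v i * v j * Real.cos (((i : ℝ) - (j : ℝ)) * x) = Real.pi * (v i * v i) := by
    intro i
    rw [intervalIntegral.integral_finsetSum fun j _ => hii i j]
    simp_rw [intervalIntegral.integral_const_mul, hcos]
    simp [mul_comm]
  simp_rw [hrow]
  simp [dotProduct, Finset.mul_sum]

lemma integral_sum_mul_spectral {H δ : ℝ} (h0 : 0 < H) (h1 : H < 1) {N : ℕ}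
    (v : Fin N → ℝ) :
    IntegrableOn (fun x : ℝ => (∑ i, ∑ j, v i * v j * Real.cos (((i : ℝ) - (j : ℝ)) * x))
      * ((1 - Real.cos x) * x ^ (-1 - 2 * H))) (Set.Ioi 0) ∧
    δ ^ (2 * H) * ∫ x in Set.Ioi (0 : ℝ),
      (∑ i, ∑ j, v i * v j * Real.cos (((i : ℝ) - (j : ℝ)) * x))
        * ((1 - Real.cos x) * x ^ (-1 - 2 * H))
      = spectralConst H * (v ⬝ᵥ (SigmaH H δ N *ᵥ v)) := by
  have key := fun i j : Fin N => integral_cos_mul_one_sub_cos h0 h1 ((i : ℝ) - (j : ℝ))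
  have heq : (fun x : ℝ => (∑ i, ∑ j, v i * v j * Real.cos (((i : ℝ) - (j : ℝ)) * x))
      * ((1 - Real.cos x) * x ^ (-1 - 2 * H))) = fun x => ∑ i, ∑ j, v i * v j *
      (Real.cos (((i : ℝ) - (j : ℝ)) * x) * ((1 - Real.cos x) * x ^ (-1 - 2 * H))) := by
    funext x
    simp only [Finset.sum_mul, mul_assoc]
  have hij := fun i j : Fin N => (key i j).1.const_mul (v i * v j)
  rw [heq]
  refine ⟨integrable_finsetSum _ fun i _ => integrable_finsetSum _ fun j _ => hij i j, ?_⟩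
  rw [integral_finsetSum _ fun i _ => integrable_finsetSum _ fun j _ => hij i j]
  simp_rw [integral_finsetSum _ fun j _ => hij _ j, integral_const_mul, fun i j => (key i j).2]
  simp only [dotProduct, mulVec, SigmaH, Finset.mul_sum]
  refine Finset.sum_congr rfl fun i _ => Finset.sum_congr rfl fun j _ => ?_
  ring

lemma sum_mul_cos_sub_nonneg {N : ℕ} (v : Fin N → ℝ) (x : ℝ) :
    0 ≤ ∑ i, ∑ j, v i * v j * Real.cos (((i : ℝ) - (j : ℝ)) * x) := by
  rw [sum_mul_cos_sub]; positivity

lemma dotProduct_self_nonneg_real {N : ℕ} (v : Fin N → ℝ) : 0 ≤ v ⬝ᵥ v :=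
  Finset.sum_nonneg fun i _ => mul_self_nonneg (v i)

lemma spectralDensity_lower_bound {H : ℝ} {N : ℕ} (hN : 0 < N) {x : ℝ}
    (hx : Real.pi / (2 * N) ≤ x) (hx' : x ≤ Real.pi) :
    2 / Real.pi ^ 2 * min (Real.pi ^ (1 - 2 * H)) ((Real.pi / 2) ^ (1 - 2 * H))
      * min 1 ((N : ℝ) ^ (2 * H - 1)) ≤ (1 - Real.cos x) * x ^ (-1 - 2 * H) := by
  have hpi := Real.pi_pos
  have hN' : (0 : ℝ) < N := by exact_mod_cast hN
  have hx0 : 0 < x := lt_of_lt_of_le (by positivity) hx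
  have hcos : 2 / Real.pi ^ 2 * x ^ 2 ≤ 1 - Real.cos x := by
    have := Real.cos_le_one_sub_mul_cos_sq (x := x) (by rw [abs_of_pos hx0]; exact hx')
    linarith
  have hpow : x ^ (1 - 2 * H) = x ^ 2 * x ^ (-1 - 2 * H) := by
    rw [← Real.rpow_natCast, ← Real.rpow_add hx0]; congr 1; push_cast; ring
  have hlow : min (Real.pi ^ (1 - 2 * H)) ((Real.pi / 2) ^ (1 - 2 * H))
      * min 1 ((N : ℝ) ^ (2 * H - 1)) ≤ x ^ (1 - 2 * H) := by
    rcases le_total (1 - 2 * H) 0 with h | h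
    · refine le_trans (mul_le_of_le_one_right (by positivity) (min_le_left _ _)) ?_
      exact (min_le_left _ _).trans (Real.rpow_le_rpow_of_nonpos hx0 hx' h)
    · calc _ ≤ (Real.pi / 2) ^ (1 - 2 * H) * (N : ℝ) ^ (2 * H - 1) := by
            gcongr
            · exact min_le_right _ _
            · exact min_le_right _ _
        _ = (Real.pi / (2 * N)) ^ (1 - 2 * H) := by
            rw [← div_div, Real.div_rpow (by positivity : 0 ≤ Real.pi / 2) hN'.le,
              show 2 * H - 1 = -(1 - 2 * H) by ring, Real.rpow_neg hN'.le]
            rfl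
        _ ≤ _ := Real.rpow_le_rpow (by positivity) hx h
  calc _ = 2 / Real.pi ^ 2 * (min (Real.pi ^ (1 - 2 * H)) ((Real.pi / 2) ^ (1 - 2 * H))
      * min 1 ((N : ℝ) ^ (2 * H - 1))) := by ring
    _ ≤ 2 / Real.pi ^ 2 * x ^ (1 - 2 * H) := by gcongr
    _ = 2 / Real.pi ^ 2 * x ^ 2 * x ^ (-1 - 2 * H) := by rw [hpow]; ring
    _ ≤ _ := by gcongr

/-- Lower bound for the smallest eigenvalue of the fractional Gaussian noise covariance. -/
lemma exists_SigmaH_lower_bound {H : ℝ} (h0 : 0 < H) (h1 : H < 1) :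
    ∃ c : ℝ, 0 < c ∧ ∀ (δ : ℝ) (N : ℕ), 0 < δ → 0 < N → ∀ v : Fin N → ℝ,
      c * δ ^ (2 * H) * min 1 ((N : ℝ) ^ (2 * H - 1)) * (v ⬝ᵥ v)
        ≤ v ⬝ᵥ (SigmaH H δ N *ᵥ v) := by
  have hpi := Real.pi_pos
  have hK := spectralConst_pos h0 h1
  set m : ℝ := 2 / Real.pi ^ 2 * min (Real.pi ^ (1 - 2 * H)) ((Real.pi / 2) ^ (1 - 2 * H))
    with hm
  have hm0 : 0 < m := by
    have := lt_min (Real.rpow_pos_of_pos hpi (1 - 2 * H))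
      (Real.rpow_pos_of_pos (half_pos hpi) (1 - 2 * H))
    positivity
  refine ⟨m * (Real.pi / 2) / spectralConst H, by positivity, fun δ N hδ hN v => ?_⟩
  have hN' : (0 : ℝ) < N := by exact_mod_cast hN
  have hN1 : (1 : ℝ) ≤ N := by exact_mod_cast hN
  obtain ⟨hi, he⟩ := integral_sum_mul_spectral (δ := δ) h0 h1 v
  set P : ℝ → ℝ := fun x => ∑ i, ∑ j, v i * v j * Real.cos (((i : ℝ) - (j : ℝ)) * x) with hP
  have hPc : Continuous P := by fun_prop
  have hP0 : ∀ x, 0 ≤ P x := sum_mul_cos_sub_nonneg v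
  set η : ℝ := Real.pi / (2 * N) with hη
  have hη0 : 0 < η := by positivity
  have hηpi : η ≤ Real.pi := by
    rw [hη, div_le_iff₀ (by positivity)]; nlinarith
  have hmass : Real.pi / 2 * (v ⬝ᵥ v) ≤ ∫ x in η..Real.pi, P x := by
    have hsplit := intervalIntegral.integral_add_adjacent_intervals
      (hPc.intervalIntegrable (μ := volume) 0 η) (hPc.intervalIntegrable η Real.pi)
    rw [integral_sum_mul_cos_sub v] at hsplit
    have hsmall : ∫ x in (0 : ℝ)..η, P x ≤ ∫ _ in (0 : ℝ)..η, N * (v ⬝ᵥ v) :=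
      intervalIntegral.integral_mono_on hη0.le (hPc.intervalIntegrable _ _)
        (by simp) fun x _ => sum_mul_cos_sub_le v x
    rw [intervalIntegral.integral_const, sub_zero, smul_eq_mul] at hsmall
    have : η * (N * (v ⬝ᵥ v)) = Real.pi / 2 * (v ⬝ᵥ v) := by rw [hη]; field_simp
    linarith
  set M : ℝ := min 1 ((N : ℝ) ^ (2 * H - 1)) with hM
  have hM0 : 0 < M := lt_min one_pos (by positivity)
  have hint : m * M * ∫ x in η..Real.pi, P x
      ≤ ∫ x in Set.Ioi (0 : ℝ), P x * ((1 - Real.cos x) * x ^ (-1 - 2 * H)) := by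
    have hsub : Set.Ioc η Real.pi ⊆ Set.Ioi 0 := fun x hx => hη0.trans hx.1
    have hnn : ∀ x ∈ Set.Ioi (0 : ℝ), 0 ≤ P x * ((1 - Real.cos x) * x ^ (-1 - 2 * H)) :=
      fun x hx => mul_nonneg (hP0 x)
        (mul_nonneg (by linarith [Real.cos_le_one x]) (Real.rpow_nonneg (le_of_lt hx) _))
    refine le_trans ?_ (setIntegral_mono_set hi
      ((ae_restrict_mem measurableSet_Ioi).mono hnn) hsub.eventuallyLE)
    rw [intervalIntegral.integral_of_le hηpi, ← integral_const_mul]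
    refine setIntegral_mono_on ?_ (hi.mono_set hsub) measurableSet_Ioc fun x hx => ?_
    · exact ((hPc.intervalIntegrable η Real.pi).1).const_mul _
    · rw [mul_comm]
      exact mul_le_mul_of_nonneg_left
        (spectralDensity_lower_bound hN hx.1.le hx.2) (hP0 x)
  have hfin : spectralConst H * (m * (Real.pi / 2) / spectralConst H * δ ^ (2 * H) * M * (v ⬝ᵥ v))
      ≤ spectralConst H * (v ⬝ᵥ (SigmaH H δ N *ᵥ v)) := by
    rw [← he]
    calc _ = δ ^ (2 * H) * (m * M * (Real.pi / 2 * (v ⬝ᵥ v))) := by field_simp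
      _ ≤ δ ^ (2 * H) * (m * M * ∫ x in η..Real.pi, P x) := by gcongr
      _ ≤ _ := by gcongr
  exact le_of_mul_le_mul_left hfin hK

lemma posDef_of_dotProduct_lower_bound {N : ℕ} {M : Matrix (Fin N) (Fin N) ℝ} {l : ℝ}
    (hl : 0 < l) (hsymm : Mᵀ = M) (hM : ∀ v, l * (v ⬝ᵥ v) ≤ v ⬝ᵥ (M *ᵥ v)) : M.PosDef := by
  refine Matrix.PosDef.of_dotProduct_mulVec_pos (by simpa [Matrix.IsHermitian] using hsymm) ?_
  intro x hx
  have : 0 < x ⬝ᵥ x := by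
    refine lt_of_le_of_ne (dotProduct_self_nonneg_real x) fun h => hx ?_
    exact dotProduct_self_eq_zero.1 h.symm
  simpa using lt_of_lt_of_le (mul_pos hl this) (hM x)

lemma dotProduct_inv_mulVec_le {N : ℕ} {M : Matrix (Fin N) (Fin N) ℝ} {l : ℝ}
    (hl : 0 < l) (hsymm : Mᵀ = M) (hM : ∀ v, l * (v ⬝ᵥ v) ≤ v ⬝ᵥ (M *ᵥ v)) (w : Fin N → ℝ) :
    w ⬝ᵥ (M⁻¹ *ᵥ w) ≤ l⁻¹ * (w ⬝ᵥ w) := by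
  have hdet : IsUnit M.det :=
    (Matrix.isUnit_iff_isUnit_det _).1 (posDef_of_dotProduct_lower_bound hl hsymm hM).isUnit
  set v := M⁻¹ *ᵥ w with hv
  have hMv : M *ᵥ v = w := by rw [hv, mulVec_mulVec, Matrix.mul_nonsing_inv _ hdet, one_mulVec]
  have h1 := hM v
  rw [hMv, dotProduct_comm v w] at h1
  have h2 := dotProduct_self_nonneg_real (w - l • v)
  rw [sub_dotProduct, dotProduct_sub, dotProduct_sub] at h2
  simp only [smul_dotProduct, dotProduct_smul, smul_eq_mul, dotProduct_comm v w] at h2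
  rw [inv_mul_eq_div, le_div_iff₀ hl]
  nlinarith

open scoped MatrixOrder in
lemma exists_whitening {N : ℕ} {M : Matrix (Fin N) (Fin N) ℝ} (hM : M.PosDef) :
    ∃ S : Matrix (Fin N) (Fin N) ℝ, M⁻¹ = Sᵀ * S ∧ S * M * Sᵀ = 1 := by
  have hdet : IsUnit M.det := (Matrix.isUnit_iff_isUnit_det _).1 hM.isUnit
  obtain ⟨S, hS⟩ := CStarAlgebra.nonneg_iff_eq_star_mul_self.mp hM.inv.posSemidef.nonneg
  have hS' : M⁻¹ = Sᵀ * S := by simpa [Matrix.star_eq_conjTranspose] using hS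
  refine ⟨S, hS', ?_⟩
  rw [mul_eq_one_comm, ← Matrix.mul_assoc, ← hS', Matrix.nonsing_inv_mul _ hdet]

lemma map_mulVec_eq_pi_gaussianReal {Ω : Type*} [MeasurableSpace Ω] {P : Measure Ω}
    [IsProbabilityMeasure P] {N : ℕ} {b : Ω → Fin N → ℝ} (hb : Measurable b)
    {M S : Matrix (Fin N) (Fin N) ℝ}
    (hlaw : ∀ u : Fin N → ℝ,
      P.map (fun ω => u ⬝ᵥ b ω) = gaussianReal 0 (u ⬝ᵥ (M *ᵥ u)).toNNReal)
    (hS : S * M * Sᵀ = 1) :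
    P.map (fun ω => S *ᵥ b ω) = Measure.pi fun _ => gaussianReal 0 1 := by
  have hSb : Measurable fun ω => S *ᵥ b ω := by
    refine measurable_pi_iff.2 fun i => ?_
    simp only [mulVec, dotProduct]
    fun_prop
  have : IsProbabilityMeasure (P.map fun ω => S *ᵥ b ω) :=
    Measure.isProbabilityMeasure_map hSb.aemeasurable
  rw [← charFun_eq_pi_iff]
  intro t
  have key : charFun ((P.map fun ω => S *ᵥ b ω).map (WithLp.toLp 2)) t
      = charFun (P.map fun ω => (Sᵀ *ᵥ t.ofLp) ⬝ᵥ b ω) 1 := by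
    have hm : Measurable fun ω => (Sᵀ *ᵥ t.ofLp) ⬝ᵥ b ω := by
      simp only [dotProduct]
      fun_prop
    rw [charFun_apply, charFun_apply, Measure.map_map (by fun_prop) hSb,
      integral_map (by fun_prop) (by fun_prop), integral_map (by fun_prop) (by fun_prop)]
    refine integral_congr_ae (.of_forall fun ω => ?_)
    have : inner ℝ (WithLp.toLp 2 (S *ᵥ b ω)) t = (Sᵀ *ᵥ t.ofLp) ⬝ᵥ b ω := by
      rw [EuclideanSpace.inner_eq_star_dotProduct, mulVec_transpose, ← dotProduct_mulVec]
      simp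
    simp [this]
  have hone : (Sᵀ *ᵥ t.ofLp) ⬝ᵥ (M *ᵥ (Sᵀ *ᵥ t.ofLp)) = ∑ i, t i ^ 2 := by
    rw [mulVec_transpose, ← dotProduct_mulVec, ← mulVec_transpose, mulVec_mulVec, mulVec_mulVec,
      hS, one_mulVec]
    simp [dotProduct, sq]
  rw [key, hlaw, hone, charFun_gaussianReal]
  simp_rw [charFun_gaussianReal]
  rw [← Complex.exp_sum, Real.coe_toNNReal _ (by positivity)]
  congr 1
  push_cast
  simp [Finset.sum_div, Finset.sum_neg_distrib]

lemma SigmaH_transpose (H δ : ℝ) (N : ℕ) : (SigmaH H δ N)ᵀ = SigmaH H δ N := by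
  ext i j
  simp only [transpose_apply, SigmaH]
  rw [show (j : ℝ) - i + 1 = -((i : ℝ) - j - 1) by ring,
    show (j : ℝ) - i - 1 = -((i : ℝ) - j + 1) by ring,
    show (j : ℝ) - i = -((i : ℝ) - j) by ring, abs_neg, abs_neg, abs_neg]
  ring

lemma fbmCov_increment {H δ : ℝ} (hδ : 0 < δ) (x y : ℝ) :
    fbmCov H ((x + 1) * δ) ((y + 1) * δ) - fbmCov H ((x + 1) * δ) (y * δ)
      - fbmCov H (x * δ) ((y + 1) * δ) + fbmCov H (x * δ) (y * δ)
      = δ ^ (2 * H) / 2 * (|x - y + 1| ^ (2 * H) + |x - y - 1| ^ (2 * H)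
        - 2 * |x - y| ^ (2 * H)) := by
  have hmul : ∀ z : ℝ, |z * δ| ^ (2 * H) = |z| ^ (2 * H) * δ ^ (2 * H) := fun z => by
    rw [abs_mul, abs_of_pos hδ, Real.mul_rpow (abs_nonneg _) hδ.le]
  simp only [fbmCov, ← sub_mul, hmul]
  rw [show x + 1 - (y + 1) = x - y by ring, show x + 1 - y = x - y + 1 by ring,
    show x - (y + 1) = x - y - 1 by ring]
  ring

lemma IsTwoSidedFBM.map_dotProduct_increments {Ω : Type*} [MeasureSpace Ω] {H δ : ℝ}
    {B : ℝ → Ω → ℝ} (hB : IsTwoSidedFBM H B) (hδ : 0 < δ) {N : ℕ} (u : Fin N → ℝ) :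
    Measure.map (fun ω => u ⬝ᵥ fun k : Fin N =>
      B (((k : ℕ) + 1 : ℝ) * δ) ω - B ((k : ℕ) * δ) ω) (ℙ : Measure Ω)
      = gaussianReal 0 (u ⬝ᵥ (SigmaH H δ N *ᵥ u)).toNNReal := by
  have h := hB.gaussian (N + N)
    (Fin.append (fun k : Fin N => ((k : ℕ) + 1 : ℝ) * δ) fun k : Fin N => ((k : ℕ) : ℝ) * δ)
    (Fin.append u (-u))
  simp only [Fin.sum_univ_add, Fin.append_left, Fin.append_right] at h
  convert! h using 2
  · funext ω
    simp only [dotProduct, ← Finset.sum_add_distrib]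
    refine Finset.sum_congr rfl fun k _ => ?_
    simp; ring
  · congr 1
    simp only [dotProduct, mulVec, Finset.mul_sum, ← Finset.sum_add_distrib]
    refine Finset.sum_congr rfl fun i _ => Finset.sum_congr rfl fun j _ => ?_
    rw [SigmaH, ← fbmCov_increment hδ]
    simp; ring

lemma integral_pow_four_gaussianReal : ∫ x, x ^ 4 ∂(gaussianReal 0 1) = 3 := by
  have key : ∀ p p' q : ℝ → ℝ, (∀ t, HasDerivAt p (p' t) t) → (∀ t, p' t + t * p t = q t) →
      deriv (fun t => p t * Real.exp (t ^ 2 / 2)) = fun t => q t * Real.exp (t ^ 2 / 2) := by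
    intro p p' q h hq
    ext t
    have h2 : HasDerivAt (fun t : ℝ => Real.exp (t ^ 2 / 2)) (Real.exp (t ^ 2 / 2) * t) t := by
      have := ((hasDerivAt_pow 2 t).div_const 2).exp
      convert! this using 2
      simp
    rw [((h t).fun_mul h2).deriv, ← hq]
    ring
  have hid : ∀ t : ℝ, HasDerivAt (fun t : ℝ => t) 1 t := hasDerivAt_id
  calc ∫ x, x ^ 4 ∂(gaussianReal 0 1)
      = iteratedDeriv 4 (mgf (fun x => x) (gaussianReal 0 1)) 0 := by
        rw [iteratedDeriv_mgf_zero] <;> simp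
    _ = 3 := by
        have h0 : mgf (fun x => x) (gaussianReal 0 1)
            = fun t => (fun _ => (1 : ℝ)) t * Real.exp (t ^ 2 / 2) := by
          rw [mgf_fun_id_gaussianReal]; ext t; simp
        rw [h0]
        simp only [iteratedDeriv_succ, iteratedDeriv_zero]
        rw [key _ (fun _ => 0) (fun t => t) (fun t => hasDerivAt_const t 1) (fun t => by simp),
          key _ (fun _ => 1) (fun t => 1 + t ^ 2) hid (fun t => by ring),
          key _ (fun t => 2 * t) (fun t => 3 * t + t ^ 3)
            (fun t => by simpa using (hasDerivAt_pow 2 t).const_add 1) (fun t => by ring),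
          key _ (fun t => 3 + 3 * t ^ 2) (fun t => 3 + 6 * t ^ 2 + t ^ 4)
            (fun t => by
              simpa using ((hid t).const_mul (3 : ℝ)).fun_add (hasDerivAt_pow 3 t))
            (fun t => by ring)]
        simp

lemma memLp_sq_gaussianReal : MemLp (fun x : ℝ => x ^ 2) 2 (gaussianReal 0 1) := by
  rw [memLp_two_iff_integrable_sq (by fun_prop)]
  have h := (memLp_id_gaussianReal' (μ := 0) (v := 1) 4 (by norm_num)).integrable_norm_pow
    (p := 4) (by norm_num)
  refine h.congr (Eventually.of_forall fun x => ?_)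
  simp only [id, Real.norm_eq_abs]
  rw [← pow_mul]
  exact (show Even 4 by decide).pow_abs x

lemma integral_sq_gaussianReal : ∫ x, x ^ 2 ∂(gaussianReal 0 1) = 1 := by
  have h := variance_fun_id_gaussianReal (μ := 0) (v := 1)
  rw [variance_eq_integral measurable_id'.aemeasurable] at h
  simpa using h

lemma variance_sq_gaussianReal : Var[fun x : ℝ => x ^ 2; gaussianReal 0 1] = 2 := by
  rw [variance_eq_sub memLp_sq_gaussianReal]
  have : (fun x : ℝ => x ^ 2) ^ 2 = fun x => x ^ 4 := by ext x; simp; ring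
  rw [this, integral_pow_four_gaussianReal, integral_sq_gaussianReal]
  norm_num

/-- The central limit theorem for sums of squares of standard Gaussian vectors of growing
dimension, possibly defined on unrelated coordinates. -/
lemma tendstoInDistribution_sum_sq {Ω : Type*} [MeasurableSpace Ω] {P : Measure Ω}
    [IsProbabilityMeasure P] {Ns : ℕ → ℕ} (hNs : Tendsto Ns atTop atTop)
    {ξ : (n : ℕ) → Ω → Fin (Ns n) → ℝ} (hmeas : ∀ n, Measurable (ξ n))
    (hlaw : ∀ n, P.map (ξ n) = Measure.pi fun _ => gaussianReal 0 1) :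
    TendstoInDistribution
      (fun n ω => (√(Ns n : ℝ))⁻¹ * (ξ n ω ⬝ᵥ ξ n ω - Ns n)) atTop
      (id : ℝ → ℝ) (fun _ => P) (gaussianReal 0 2) := by
  obtain ⟨Ω', _, P', X, hXm, hXlaw, hXind, hP'⟩ := exists_iid ℕ (gaussianReal 0 1)
  have hsq : Measurable fun x : ℝ => x ^ 2 := by fun_prop
  have hvar : Var[fun ω => X 0 ω ^ 2; P'] = 2 := by
    rw [← variance_sq_gaussianReal, ← (hXlaw 0).map_eq,
      variance_map hsq.aemeasurable (hXm 0).aemeasurable]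
    rfl
  have hmean : ∫ ω, X 0 ω ^ 2 ∂P' = 1 := by
    rw [← integral_sq_gaussianReal, ← (hXlaw 0).map_eq,
      integral_map (hXm 0).aemeasurable hsq.aestronglyMeasurable]
  have hclt := tendstoInDistribution_inv_sqrt_mul_sum_sub (P := P') (P' := gaussianReal 0 2)
    (X := fun i ω => X i ω ^ 2) (Y := id)
    ⟨aemeasurable_id, by rw [Measure.map_id, hvar]; norm_num⟩
    (by
      have h := memLp_sq_gaussianReal
      rw [← (hXlaw 0).map_eq] at h
      exact h.comp_of_map (hXm 0).aemeasurable)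
    (hXind.comp (fun _ x => x ^ 2) fun _ => hsq)
    (fun i => (IdentDistrib.mk (hXm i).aemeasurable (hXm 0).aemeasurable
      ((hXlaw i).map_eq.trans (hXlaw 0).map_eq.symm)).comp hsq)
  rw [hmean] at hclt
  have hm : ∀ n, Measurable fun ω => (√(Ns n : ℝ))⁻¹ * (ξ n ω ⬝ᵥ ξ n ω - Ns n) := by
    intro n
    have := hmeas n
    unfold dotProduct
    fun_prop
  refine ⟨fun n => (hm n).aemeasurable, aemeasurable_id, ?_⟩
  refine (hclt.tendsto.comp hNs).congr fun n => ?_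
  apply Subtype.ext
  have hφ : Measurable fun x : Fin (Ns n) → ℝ => (√(Ns n : ℝ))⁻¹ * (x ⬝ᵥ x - Ns n) := by
    unfold dotProduct
    fun_prop
  have h1 : P.map (fun ω => (√(Ns n : ℝ))⁻¹ * (ξ n ω ⬝ᵥ ξ n ω - Ns n))
      = (Measure.pi fun _ => gaussianReal 0 1).map
        fun x : Fin (Ns n) → ℝ => (√(Ns n : ℝ))⁻¹ * (x ⬝ᵥ x - Ns n) := by
    rw [← hlaw n, Measure.map_map hφ (hmeas n)]
    rfl
  have hpi : P'.map (fun ω (i : Fin (Ns n)) => X i ω) = Measure.pi fun _ => gaussianReal 0 1 :=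
    (iIndepFun.hasLaw_pi (fun i : Fin (Ns n) => hXlaw i)
      (hXind.precomp Fin.val_injective)).map_eq
  change P'.map _ = P.map _
  rw [h1, ← hpi, Measure.map_map hφ (by fun_prop)]
  congr 1
  ext ω
  simp only [Function.comp, dotProduct, Finset.sum_range, mul_one, sq]

/-- The exponentially weighted moving average `(1/ε) ∫_{−∞}^t e^{−(t−s)/ε} b(s) ds`. -/
def expAverage (ε : ℝ) (b : ℝ → ℝ) (t : ℝ) : ℝ :=
  (1 / ε) * ∫ s in Set.Iic t, Real.exp (-(t - s) / ε) * b s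

lemma exp_neg_sub_div (ε t s : ℝ) :
    Real.exp (-(t - s) / ε) = Real.exp (-t / ε) * Real.exp (ε⁻¹ * s) := by
  rw [← Real.exp_add]; ring_nf

lemma integrableOn_exp_neg_sub_div {ε : ℝ} (hε : 0 < ε) (t : ℝ) :
    IntegrableOn (fun s => Real.exp (-(t - s) / ε)) (Set.Iic t) := by
  simp only [exp_neg_sub_div]
  exact (integrableOn_exp_mul_Iic (inv_pos.2 hε) t).const_mul _

lemma expAverage_const {ε : ℝ} (hε : 0 < ε) (c t : ℝ) : expAverage ε (fun _ => c) t = c := by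
  simp only [expAverage, exp_neg_sub_div, mul_assoc]
  rw [integral_const_mul, integral_mul_const, integral_exp_mul_Iic (inv_pos.2 hε)]
  have h : Real.exp (-t / ε) * Real.exp (ε⁻¹ * t) = 1 := by
    rw [← exp_neg_sub_div]; simp
  field_simp at h ⊢
  linear_combination c * h

lemma integrableOn_exp_mul_of_abs {ε t : ℝ} {b : ℝ → ℝ} (hb : Continuous b)
    (h : IntegrableOn (fun s => Real.exp (-(t - s) / ε) * |b s|) (Set.Iic t)) :
    IntegrableOn (fun s => Real.exp (-(t - s) / ε) * b s) (Set.Iic t) := by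
  refine Integrable.mono h (by fun_prop) (Eventually.of_forall fun s => ?_)
  simp

/-- The exponential average `G` of a continuous path `b` solves `G' = (b − G) / ε`. -/
lemma hasDerivAt_expAverage {ε : ℝ} {b : ℝ → ℝ} (hb : Continuous b)
    (h : ∀ t, IntegrableOn (fun s => Real.exp (-(t - s) / ε) * b s) (Set.Iic t)) (t : ℝ) :
    HasDerivAt (expAverage ε b) ((1 / ε) * (b t - expAverage ε b t)) t := by
  have hi : ∀ t, IntegrableOn (fun s => Real.exp (ε⁻¹ * s) * b s) (Set.Iic t) := fun t => by
    refine Integrable.congr ((h t).const_mul (Real.exp (t / ε))) (Eventually.of_forall fun s => ?_)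
    simp only [exp_neg_sub_div]
    rw [← mul_assoc, ← mul_assoc, ← Real.exp_add]
    simp [neg_div]
  have hG : expAverage ε b = fun t => (1 / ε) * (Real.exp (-t / ε) *
      ((∫ s in Set.Iic 0, Real.exp (ε⁻¹ * s) * b s)
        + ∫ s in (0 : ℝ)..t, Real.exp (ε⁻¹ * s) * b s)) := by
    ext t
    rw [← intervalIntegral.integral_Iic_sub_Iic (hi 0) (hi t), add_sub_cancel,
      ← integral_const_mul]
    simp only [expAverage, exp_neg_sub_div, mul_assoc]
  have hc : Continuous fun s => Real.exp (ε⁻¹ * s) * b s := by fun_prop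
  have hd := ((hasDerivAt_neg t).div_const ε).exp.fun_mul
    ((hc.integral_hasStrictDerivAt 0 t).hasDerivAt.const_add
      (∫ s in Set.Iic 0, Real.exp (ε⁻¹ * s) * b s))
  have hd' := hd.const_mul (1 / ε)
  rw [hG]
  refine hd'.congr_deriv ?_
  have h1 : Real.exp (-t / ε) * Real.exp (ε⁻¹ * t) = 1 := by
    rw [← exp_neg_sub_div]; simp
  linear_combination (1 / ε) * b t * h1

lemma integral_sub_expAverage {ε : ℝ} {b : ℝ → ℝ} (hb : Continuous b)
    (h : ∀ t, IntegrableOn (fun s => Real.exp (-(t - s) / ε) * b s) (Set.Iic t)) (t : ℝ) :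
    ∫ s in (0 : ℝ)..t, (1 / ε) * (b s - expAverage ε b s)
      = expAverage ε b t - expAverage ε b 0 := by
  have hG : Continuous (expAverage ε b) :=
    continuous_iff_continuousAt.2 fun t => (hasDerivAt_expAverage hb h t).continuousAt
  exact intervalIntegral.integral_eq_sub_of_hasDerivAt
    (fun s _ => hasDerivAt_expAverage hb h s)
    (Continuous.intervalIntegrable (by fun_prop) _ _)

lemma ofReal_integral_le_lintegral {α : Type*} [MeasurableSpace α] {μ : Measure α} {f : α → ℝ}
    (hf : Integrable f μ) : ENNReal.ofReal (∫ x, f x ∂μ) ≤ ∫⁻ x, ENNReal.ofReal (f x) ∂μ := by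
  rw [integral_eq_lintegral_pos_part_sub_lintegral_neg_part hf]
  exact ENNReal.ofReal_le_of_le_toReal (sub_le_self _ ENNReal.toReal_nonneg)

/-- Jensen's inequality for the exponential average. -/
lemma ofReal_sq_sub_expAverage_le {ε : ℝ} (hε : 0 < ε) {b : ℝ → ℝ} {t : ℝ}
    (h : IntegrableOn (fun s => Real.exp (-(t - s) / ε) * b s) (Set.Iic t)) :
    ENNReal.ofReal ((b t - expAverage ε b t) ^ 2)
      ≤ ∫⁻ s in Set.Iic t, ENNReal.ofReal
        ((1 / ε) * Real.exp (-(t - s) / ε) * (b t - b s) ^ 2) := by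
  set m := b t - expAverage ε b t with hm
  have h0 := integrableOn_exp_neg_sub_div hε t
  have h1 : (1 / ε) * ∫ s in Set.Iic t, Real.exp (-(t - s) / ε) = 1 := by
    simpa [expAverage] using expAverage_const hε 1 t
  have hint : IntegrableOn (fun s => (1 / ε) * ((2 * m * b t - m ^ 2) *
      Real.exp (-(t - s) / ε) - 2 * m * (Real.exp (-(t - s) / ε) * b s))) (Set.Iic t) :=
    ((h0.const_mul _).sub (h.const_mul _)).const_mul _
  have hval : ∫ s in Set.Iic t, (1 / ε) * ((2 * m * b t - m ^ 2) *
      Real.exp (-(t - s) / ε) - 2 * m * (Real.exp (-(t - s) / ε) * b s)) = m ^ 2 := by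
    rw [integral_const_mul, integral_sub (h0.const_mul _) (h.const_mul _), integral_const_mul,
      integral_const_mul]
    rw [expAverage] at hm
    linear_combination (2 * m * b t - m ^ 2) * h1 - 2 * m * hm
  rw [← hval]
  refine (ofReal_integral_le_lintegral hint).trans (lintegral_mono fun s => ?_)
  refine ENNReal.ofReal_le_ofReal ?_
  have : 0 ≤ (1 / ε) * Real.exp (-(t - s) / ε) := by positivity
  nlinarith [mul_nonneg this (sq_nonneg (b t - b s - m))]

lemma lintegral_exp_mul_abs_rpow {H ε : ℝ} (h0 : 0 < H) (hε : 0 < ε) (t : ℝ) :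
    ∫⁻ s in Set.Iic t, ENNReal.ofReal
      ((1 / ε) * Real.exp (-(t - s) / ε) * |t - s| ^ (2 * H))
      = ENNReal.ofReal (Real.Gamma (2 * H + 1) * ε ^ (2 * H)) := by
  have hval := Real.integral_rpow_mul_exp_neg_mul_Ioi (a := 2 * H + 1) (r := 1 / ε)
    (by positivity) (by positivity)
  have hpos : 0 < (1 / (1 / ε)) ^ (2 * H + 1) * Real.Gamma (2 * H + 1) :=
    mul_pos (by positivity) (Real.Gamma_pos_of_pos (by positivity))
  have hint : IntegrableOn (fun x : ℝ => x ^ (2 * H + 1 - 1) * Real.exp (-(1 / ε * x)))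
      (Set.Ioi 0) := by
    by_contra hn
    rw [integral_undef hn] at hval
    exact hpos.ne hval
  rw [← lintegral_indicator measurableSet_Iic]
  rw [← lintegral_sub_left_eq_self _ t]
  calc _ = ∫⁻ s in Set.Ici 0, ENNReal.ofReal
          ((1 / ε) * (s ^ (2 * H + 1 - 1) * Real.exp (-(1 / ε * s)))) := by
        rw [← lintegral_indicator measurableSet_Ici]
        refine lintegral_congr fun s => ?_
        by_cases hs : 0 ≤ s
        · rw [Set.indicator_of_mem (by simpa using hs), Set.indicator_of_mem (by simpa using hs)]
          simp only [sub_sub_cancel, abs_of_nonneg hs, add_sub_cancel_right]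
          ring_nf
        · rw [Set.indicator_of_notMem (by simpa using hs),
            Set.indicator_of_notMem (by simpa using hs)]
    _ = _ := by
        rw [setLIntegral_congr Ioi_ae_eq_Ici.symm, ← ofReal_integral_eq_lintegral_ofReal
          (hint.const_mul _), integral_const_mul, hval]
        · congr 1
          rw [one_div_one_div, Real.rpow_add_one hε.ne']
          field_simp
        · filter_upwards [ae_restrict_mem measurableSet_Ioi] with s hs
          have : (0 : ℝ) < s := hs
          positivity

lemma lintegral_sq_gaussianReal (v : NNReal) :
    ∫⁻ x, ENNReal.ofReal (x ^ 2) ∂(gaussianReal 0 v) = v := by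
  have h := variance_fun_id_gaussianReal (μ := 0) (v := v)
  rw [variance_eq_integral measurable_id'.aemeasurable] at h
  simp only [integral_id_gaussianReal, sub_zero] at h
  have hint : Integrable (fun x : ℝ => x ^ 2) (gaussianReal 0 v) :=
    (memLp_id_gaussianReal' (μ := 0) (v := v) 2 (by norm_num)).integrable_sq
  rw [← ofReal_integral_eq_lintegral_ofReal hint (Eventually.of_forall fun x => sq_nonneg x), h]
  simp

section FractionalBrownianMotion

variable {Ω : Type*} [MeasureSpace Ω] {H ε : ℝ} {B : ℝ → Ω → ℝ}

lemma IsTwoSidedFBM.lintegral_sq_sub (hB : IsTwoSidedFBM H B) (h0 : 0 < H) (t s : ℝ) :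
    ∫⁻ ω, ENNReal.ofReal ((B t ω - B s ω) ^ 2) = ENNReal.ofReal (|t - s| ^ (2 * H)) := by
  have h := hB.gaussian 2 ![t, s] ![1, -1]
  have hz : (0 : ℝ) ^ (2 * H) = 0 := Real.zero_rpow (by positivity)
  have hv : ∑ i, ∑ j, (![1, -1] : Fin 2 → ℝ) i * ![1, -1] j * fbmCov H (![t, s] i) (![t, s] j)
      = |t - s| ^ (2 * H) := by
    simp only [Fin.sum_univ_two, fbmCov, Matrix.cons_val_zero, Matrix.cons_val_one, sub_self,
      abs_zero, hz, abs_sub_comm s t]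
    ring
  rw [hv] at h
  have hm : ∀ t, Measurable (B t) := hB.meas
  have h2 : ∫⁻ ω, ENNReal.ofReal ((B t ω - B s ω) ^ 2)
      = ∫⁻ x, ENNReal.ofReal (x ^ 2)
        ∂(Measure.map (fun ω => ∑ i, (![1, -1] : Fin 2 → ℝ) i * B (![t, s] i) ω) ℙ) := by
    rw [lintegral_map (by fun_prop) (by fun_prop)]
    refine lintegral_congr fun ω => ?_
    simp [Fin.sum_univ_two, sub_eq_add_neg]
  rw [h2, h, lintegral_sq_gaussianReal]
  rfl

lemma IsTwoSidedFBM.measurable_uncurry (hB : IsTwoSidedFBM H B)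
    (hc : ∀ ω, Continuous fun t => B t ω) : Measurable (Function.uncurry B) :=
  measurable_uncurry_of_continuous_of_measurable hc hB.meas

lemma IsTwoSidedFBM.measurable_expAverage (hB : IsTwoSidedFBM H B)
    (hc : ∀ ω, Continuous fun t => B t ω) (ε t : ℝ) :
    Measurable fun ω => expAverage ε (fun s => B s ω) t := by
  have hm := hB.measurable_uncurry hc
  have h : StronglyMeasurable fun p : Ω × ℝ => Real.exp (-(t - p.2) / ε) * B p.2 p.1 :=
    (Measurable.mul (by fun_prop) (hm.comp measurable_swap)).stronglyMeasurable
  exact (h.integral_prod_right (ν := volume.restrict (Set.Iic t))).measurable.const_mul _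

/-- The distance in mean square between fractional Brownian motion and its exponential average
is at most of order `ε ^ H`. -/
lemma IsTwoSidedFBM.lintegral_sq_sub_expAverage_le [SFinite (ℙ : Measure Ω)]
    (hB : IsTwoSidedFBM H B)
    (hc : ∀ ω, Continuous fun t => B t ω) (h0 : 0 < H) (hε : 0 < ε)
    (hInt : ∀ᵐ ω : Ω, ∀ t : ℝ,
      IntegrableOn (fun s => Real.exp (-(t - s) / ε) * |B s ω|) (Set.Iic t)) (t : ℝ) :
    ∫⁻ ω, ENNReal.ofReal ((B t ω - expAverage ε (fun s => B s ω) t) ^ 2)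
      ≤ ENNReal.ofReal (Real.Gamma (2 * H + 1) * ε ^ (2 * H)) := by
  have hm := hB.measurable_uncurry hc
  calc _ ≤ ∫⁻ ω, ∫⁻ s in Set.Iic t, ENNReal.ofReal
          ((1 / ε) * Real.exp (-(t - s) / ε) * (B t ω - B s ω) ^ 2) := by
        refine lintegral_mono_ae ?_
        filter_upwards [hInt] with ω hω
        exact ofReal_sq_sub_expAverage_le (b := fun s => B s ω) hε
          (integrableOn_exp_mul_of_abs (hc ω) (hω t))
    _ = ∫⁻ s in Set.Iic t, ∫⁻ ω, ENNReal.ofReal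
          ((1 / ε) * Real.exp (-(t - s) / ε) * (B t ω - B s ω) ^ 2) := by
        refine lintegral_lintegral_swap (Measurable.aemeasurable ?_)
        have h1 : Measurable fun p : Ω × ℝ => B p.2 p.1 := hm.comp measurable_swap
        have h2 : Measurable fun p : Ω × ℝ => B t p.1 := (hB.meas t).comp measurable_fst
        simp only [Function.uncurry_def]
        fun_prop
    _ = _ := by
        rw [← lintegral_exp_mul_abs_rpow h0 hε t]
        refine lintegral_congr fun s => ?_
        have hp : 0 ≤ (1 / ε) * Real.exp (-(t - s) / ε) := by positivity
        simp only [ENNReal.ofReal_mul hp]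
        rw [lintegral_const_mul' _ _ ENNReal.ofReal_ne_top, hB.lintegral_sq_sub h0]

lemma slowX_eq {σ : ℝ} (hε : 0 < ε) {ω : Ω} (hc : Continuous fun t => B t ω)
    (h : ∀ t : ℝ, IntegrableOn (fun s => Real.exp (-(t - s) / ε) * |B s ω|) (Set.Iic t))
    (t : ℝ) :
    slowX H σ ε B t ω = σ * (expAverage ε (fun s => B s ω) t
      - expAverage ε (fun s => B s ω) 0) := by
  rw [← integral_sub_expAverage hc (fun t => integrableOn_exp_mul_of_abs hc (h t)) t, slowX,
    ← intervalIntegral.integral_const_mul, ← intervalIntegral.integral_const_mul]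
  refine intervalIntegral.integral_congr fun s _ => ?_
  simp only [fracOU, expAverage]
  rw [Real.rpow_sub_one hε.ne']
  have : ε ^ H ≠ 0 := by positivity
  field_simp

lemma incVec_eq {σ δ : ℝ} {N : ℕ} (hε : 0 < ε) {ω : Ω} (hc : Continuous fun t => B t ω)
    (h : ∀ t : ℝ, IntegrableOn (fun s => Real.exp (-(t - s) / ε) * |B s ω|) (Set.Iic t)) :
    incVec H σ ε δ B N ω = fun k : Fin N => σ * (expAverage ε (fun s => B s ω) (((k : ℕ) + 1 : ℝ) * δ)
      - expAverage ε (fun s => B s ω) ((k : ℕ) * δ)) := by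
  ext k
  rw [incVec, slowX_eq hε hc h, slowX_eq hε hc h]
  ring

lemma IsTwoSidedFBM.exists_continuous_version (hB : IsTwoSidedFBM H B) :
    ∃ B' : ℝ → Ω → ℝ, IsTwoSidedFBM H B' ∧ (∀ ω, Continuous fun t => B' t ω) ∧
      ∀ᵐ ω : Ω, ∀ t, B' t ω = B t ω := by
  obtain ⟨S, hS, hSm, hSc⟩ := hB.cont.exists_measurable_mem
  have hae : ∀ᵐ ω : Ω, ∀ t, S.indicator (B t) ω = B t ω := by
    filter_upwards [hS] with ω hω t using Set.indicator_of_mem hω _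
  refine ⟨fun t => S.indicator (B t), ⟨fun t => (hB.meas t).indicator hSm, ?_, ?_, ?_⟩, ?_, hae⟩
  · filter_upwards [hae, hB.cont] with ω h1 h2
    simpa only [h1] using h2
  · filter_upwards [hae, hB.zero] with ω h1 h2
    rw [h1, h2]
  · intro n t a
    rw [← hB.gaussian n t a]
    refine Measure.map_congr ?_
    filter_upwards [hae] with ω h1
    simp only [h1]
  · intro ω
    by_cases hω : ω ∈ S
    · simpa only [Set.indicator_of_mem hω] using hSc ω hω
    · simpa only [Set.indicator_of_notMem hω] using continuous_const

end FractionalBrownianMotion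

lemma lintegral_dotProduct_self_of_map_eq_pi {Ω : Type*} [MeasurableSpace Ω] {P : Measure Ω}
    {N : ℕ} {ξ : Ω → Fin N → ℝ} (hξ : Measurable ξ)
    (hlaw : P.map ξ = Measure.pi fun _ => gaussianReal 0 1) :
    ∫⁻ ω, ENNReal.ofReal (ξ ω ⬝ᵥ ξ ω) ∂P = N := by
  have hk : ∀ k, ∫⁻ ω, ENNReal.ofReal (ξ ω k ^ 2) ∂P = 1 := fun k => by
    have h := (measurePreserving_eval (fun _ : Fin N => gaussianReal 0 1) k).map_eq
    rw [← hlaw, Measure.map_map (measurable_pi_apply k) hξ] at h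
    have h1 := lintegral_sq_gaussianReal 1
    rw [← h, lintegral_map (by fun_prop) ((measurable_pi_apply k).comp hξ)] at h1
    simpa using h1
  have hm : ∀ k, Measurable fun ω => ENNReal.ofReal (ξ ω k ^ 2) := fun k => by fun_prop
  simp only [dotProduct, ← sq]
  simp_rw [ENNReal.ofReal_sum_of_nonneg fun k _ => sq_nonneg _]
  rw [lintegral_finsetSum _ fun k _ => hm k]
  simp [hk]

lemma abs_two_mul_dotProduct_add_le {N : ℕ} (x y : Fin N → ℝ) {η : ℝ} (hη : 0 < η) :
    |2 * (x ⬝ᵥ y) + y ⬝ᵥ y| ≤ η * (x ⬝ᵥ x) + (η⁻¹ + 1) * (y ⬝ᵥ y) := by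
  have h : ∀ z : ℝ, 0 ≤ η * (x ⬝ᵥ x) + 2 * z * (x ⬝ᵥ y) + η⁻¹ * z ^ 2 * (y ⬝ᵥ y) := fun z => by
    have h1 := mul_nonneg hη.le
      (dotProduct_self_nonneg_real (x + (η⁻¹ * z) • y))
    simp only [add_dotProduct, dotProduct_add, smul_dotProduct, dotProduct_smul, smul_eq_mul,
      dotProduct_comm y x] at h1
    field_simp at h1 ⊢
    linarith
  have hy := dotProduct_self_nonneg_real y
  rw [abs_le]
  constructor <;> nlinarith [h 1, h (-1)]

lemma lintegral_cross_term_le {Ω : Type*} [MeasurableSpace Ω] {P : Measure Ω}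
    {N : ℕ} {ξ y : Ω → Fin N → ℝ} (hξ : Measurable ξ)
    (hlaw : P.map ξ = Measure.pi fun _ => gaussianReal 0 1) {a : ℝ} (ha : 0 < a)
    (hya : ∫⁻ ω, ENNReal.ofReal (y ω ⬝ᵥ y ω) ∂P ≤ ENNReal.ofReal (N * a)) :
    ∫⁻ ω, ENNReal.ofReal |2 * (ξ ω ⬝ᵥ y ω) + y ω ⬝ᵥ y ω| ∂P
      ≤ ENNReal.ofReal (N * (2 * √a + a)) := by
  have hs : 0 < √a := Real.sqrt_pos.2 ha
  have hm : Measurable fun ω => ENNReal.ofReal (ξ ω ⬝ᵥ ξ ω) := by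
    unfold dotProduct; fun_prop
  calc _ ≤ ∫⁻ ω, (ENNReal.ofReal √a * ENNReal.ofReal (ξ ω ⬝ᵥ ξ ω)
        + ENNReal.ofReal ((√a)⁻¹ + 1) * ENNReal.ofReal (y ω ⬝ᵥ y ω)) ∂P := by
        refine lintegral_mono fun ω => ?_
        rw [← ENNReal.ofReal_mul hs.le, ← ENNReal.ofReal_mul (by positivity),
          ← ENNReal.ofReal_add (mul_nonneg hs.le (dotProduct_self_nonneg_real _))
            (mul_nonneg (by positivity) (dotProduct_self_nonneg_real _))]
        exact ENNReal.ofReal_le_ofReal (abs_two_mul_dotProduct_add_le _ _ hs)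
    _ = ENNReal.ofReal √a * N
        + ENNReal.ofReal ((√a)⁻¹ + 1) * ∫⁻ ω, ENNReal.ofReal (y ω ⬝ᵥ y ω) ∂P := by
        rw [lintegral_add_left (hm.const_mul _), lintegral_const_mul _ hm,
          lintegral_const_mul' _ _ ENNReal.ofReal_ne_top,
          lintegral_dotProduct_self_of_map_eq_pi hξ hlaw]
    _ ≤ ENNReal.ofReal √a * N + ENNReal.ofReal ((√a)⁻¹ + 1) * ENNReal.ofReal (N * a) := by
        gcongr
    _ = _ := by
        rw [← ENNReal.ofReal_natCast, ← ENNReal.ofReal_mul hs.le,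
          ← ENNReal.ofReal_mul (by positivity),
          ← ENNReal.ofReal_add (by positivity) (by positivity)]
        congr 1
        have h2 : (√a)⁻¹ * a = √a := by
          rw [inv_mul_eq_div, Real.div_sqrt]
        linear_combination (N : ℝ) * h2

lemma lintegral_dotProduct_sub_self_le {Ω : Type*} [MeasurableSpace Ω] {P : Measure Ω}
    {N : ℕ} {u v : Ω → Fin N → ℝ} (hu : Measurable u) {K : ℝ} (hK : 0 ≤ K)
    (hub : ∀ k, ∫⁻ ω, ENNReal.ofReal (u ω k ^ 2) ∂P ≤ ENNReal.ofReal K)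
    (hvb : ∀ k, ∫⁻ ω, ENNReal.ofReal (v ω k ^ 2) ∂P ≤ ENNReal.ofReal K)
    (hv : Measurable v) :
    ∫⁻ ω, ENNReal.ofReal ((u ω - v ω) ⬝ᵥ (u ω - v ω)) ∂P ≤ ENNReal.ofReal (N * (4 * K)) := by
  have hm : ∀ k, Measurable fun ω => ENNReal.ofReal ((u ω k - v ω k) ^ 2) := fun k => by fun_prop
  simp only [dotProduct, ← sq, Pi.sub_apply]
  simp_rw [ENNReal.ofReal_sum_of_nonneg fun k _ => sq_nonneg _]
  rw [lintegral_finsetSum _ fun k _ => hm k]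
  calc _ ≤ ∑ k : Fin N, ENNReal.ofReal (4 * K) := by
        refine Finset.sum_le_sum fun k _ => ?_
        calc _ ≤ ∫⁻ ω, (ENNReal.ofReal 2 * ENNReal.ofReal (u ω k ^ 2)
              + ENNReal.ofReal 2 * ENNReal.ofReal (v ω k ^ 2)) ∂P := by
              refine lintegral_mono fun ω => ?_
              rw [← ENNReal.ofReal_mul zero_le_two, ← ENNReal.ofReal_mul zero_le_two,
                ← ENNReal.ofReal_add (by positivity) (by positivity)]
              refine ENNReal.ofReal_le_ofReal ?_
              nlinarith [sq_nonneg (u ω k + v ω k)]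
          _ = ENNReal.ofReal 2 * (∫⁻ ω, ENNReal.ofReal (u ω k ^ 2) ∂P)
              + ENNReal.ofReal 2 * ∫⁻ ω, ENNReal.ofReal (v ω k ^ 2) ∂P := by
              rw [lintegral_add_left (by fun_prop),
                lintegral_const_mul' _ _ ENNReal.ofReal_ne_top,
                lintegral_const_mul' _ _ ENNReal.ofReal_ne_top]
          _ ≤ ENNReal.ofReal 2 * ENNReal.ofReal K + ENNReal.ofReal 2 * ENNReal.ofReal K := by
              gcongr
              exacts [hub k, hvb k]
          _ = _ := by
              rw [← ENNReal.ofReal_mul zero_le_two, ← ENNReal.ofReal_add (by positivity)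
                (by positivity)]
              congr 1; ring
    _ = _ := by
        rw [← ENNReal.ofReal_sum_of_nonneg fun _ _ => by positivity]
        simp

/-- Up to a null set, the estimator is the normalized squared length of a perturbation of a
standard Gaussian vector. -/
lemma IsTwoSidedFBM.exists_sigmaHat2_decomposition {Ω : Type*} [MeasureSpace Ω]
    [IsProbabilityMeasure (ℙ : Measure Ω)] {H ε δ l : ℝ} {B : ℝ → Ω → ℝ} {N : ℕ}
    (hB : IsTwoSidedFBM H B) (hc : ∀ ω, Continuous fun t => B t ω) (h0 : 0 < H) (hε : 0 < ε)
    (hδ : 0 < δ) (hl : 0 < l)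
    (hInt : ∀ᵐ ω : Ω, ∀ t : ℝ,
      IntegrableOn (fun s => Real.exp (-(t - s) / ε) * |B s ω|) (Set.Iic t))
    (hlow : ∀ v : Fin N → ℝ, l * (v ⬝ᵥ v) ≤ v ⬝ᵥ (SigmaH H δ N *ᵥ v)) (σ : ℝ) :
    ∃ ξ y : Ω → Fin N → ℝ, Measurable ξ ∧ Measurable y ∧
      (Measure.map ξ ℙ = Measure.pi fun _ => gaussianReal 0 1) ∧
      (∫⁻ ω, ENNReal.ofReal (y ω ⬝ᵥ y ω)
        ≤ ENNReal.ofReal (N * (l⁻¹ * (4 * (Real.Gamma (2 * H + 1) * ε ^ (2 * H)))))) ∧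
      ∀ᵐ ω, sigmaHat2 H σ ε δ B N ω
        = σ ^ 2 / N * (ξ ω ⬝ᵥ ξ ω + (2 * (ξ ω ⬝ᵥ y ω) + y ω ⬝ᵥ y ω)) := by
  obtain ⟨S, hS, hS1⟩ := exists_whitening
    (posDef_of_dotProduct_lower_bound hl (SigmaH_transpose H δ N) hlow)
  have hmB := hB.meas
  have hmG := hB.measurable_expAverage hc ε
  set Z : ℝ → Ω → ℝ := fun t ω => B t ω - expAverage ε (fun s => B s ω) t with hZ
  have hmZ : ∀ t, Measurable (Z t) := fun t => (hmB t).sub (hmG t)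
  have hZ2 := hB.lintegral_sq_sub_expAverage_le hc h0 hε hInt
  set b : Ω → Fin N → ℝ := fun ω k => B (((k : ℕ) + 1 : ℝ) * δ) ω - B ((k : ℕ) * δ) ω with hb
  set u : Ω → Fin N → ℝ := fun ω k => Z ((k : ℕ) * δ) ω with hu
  set v : Ω → Fin N → ℝ := fun ω k => Z (((k : ℕ) + 1 : ℝ) * δ) ω with hv
  have hmb : Measurable b := by fun_prop
  have hmu : Measurable u := by fun_prop
  have hmv : Measurable v := by fun_prop
  have hmS : ∀ w : Ω → Fin N → ℝ, Measurable w → Measurable fun ω => S *ᵥ w ω := fun w hw => by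
    unfold mulVec dotProduct
    fun_prop
  have hSS : ∀ w w' : Fin N → ℝ, w ⬝ᵥ ((SigmaH H δ N)⁻¹ *ᵥ w') = (S *ᵥ w) ⬝ᵥ (S *ᵥ w') := by
    intro w w'
    rw [hS, ← mulVec_mulVec, dotProduct_mulVec, vecMul_transpose]
  refine ⟨fun ω => S *ᵥ b ω, fun ω => S *ᵥ (u ω - v ω), hmS _ hmb, hmS _ (hmu.sub hmv),
    map_mulVec_eq_pi_gaussianReal hmb (hB.map_dotProduct_increments hδ) hS1, ?_, ?_⟩
  · have hK : 0 ≤ Real.Gamma (2 * H + 1) * ε ^ (2 * H) :=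
      mul_nonneg (Real.Gamma_nonneg_of_nonneg (by positivity)) (by positivity)
    calc _ ≤ ∫⁻ ω, ENNReal.ofReal l⁻¹ * ENNReal.ofReal ((u ω - v ω) ⬝ᵥ (u ω - v ω)) := by
          refine lintegral_mono fun ω => ?_
          rw [← ENNReal.ofReal_mul (by positivity), ← hSS]
          exact ENNReal.ofReal_le_ofReal
            (dotProduct_inv_mulVec_le hl (SigmaH_transpose H δ N) hlow _)
      _ ≤ ENNReal.ofReal l⁻¹ * ENNReal.ofReal
          (N * (4 * (Real.Gamma (2 * H + 1) * ε ^ (2 * H)))) := by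
          rw [lintegral_const_mul' _ _ ENNReal.ofReal_ne_top]
          gcongr
          exact lintegral_dotProduct_sub_self_le hmu hK (fun k => hZ2 _) (fun k => hZ2 _) hmv
      _ = _ := by
          rw [← ENNReal.ofReal_mul (by positivity)]
          congr 1; ring
  · filter_upwards [hInt] with ω hω
    have hV : incVec H σ ε δ B N ω = σ • (b ω + (u ω - v ω)) := by
      rw [incVec_eq hε (hc ω) hω]
      ext k
      simp only [Pi.smul_apply, Pi.add_apply, Pi.sub_apply, smul_eq_mul, hb, hu, hv, hZ]
      ring
    rw [sigmaHat2, hSS, hV]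
    simp only [mulVec_smul, mulVec_add, smul_dotProduct, dotProduct_smul, add_dotProduct,
      dotProduct_add, smul_eq_mul, dotProduct_comm (S *ᵥ (u ω - v ω)) (S *ᵥ b ω)]
    ring

/-- The rate condition: the relative error `a` in mean square is negligible against the mesh
`δ = ε ^ α`. -/
lemma tendsto_error_rate {H α T c K : ℝ} (h0 : 0 < H) (h1 : H < 1) (hT : 0 < T)
    (hα : α < min (H / (1 / 2 + H)) (H / (3 / 2 - H))) (hc : 0 < c)
    (hK : 0 < K) {εs Ns : ℕ → ℝ} (hεpos : ∀ n, 0 < εs n) (hε0 : Tendsto εs atTop (𝓝 0))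
    (hNs : ∀ n, Ns n = T / εs n ^ α) :
    Tendsto (fun n => (c * (εs n ^ α) ^ (2 * H) * min 1 (Ns n ^ (2 * H - 1)))⁻¹
      * (K * εs n ^ (2 * H)) / εs n ^ α) atTop (𝓝 0) := by
  have hp : 0 < 2 * H - α * (1 + 2 * H) := by
    have := (lt_div_iff₀ (by linarith)).1 (lt_min_iff.1 hα).1
    linarith
  have hq : 0 < 2 * H - 2 * α := by
    have ha := (lt_div_iff₀ (by linarith)).1 (lt_min_iff.1 hα).1
    have hb := (lt_div_iff₀ (by linarith)).1 (lt_min_iff.1 hα).2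
    by_contra! hcon
    nlinarith
  have hpow : ∀ r : ℝ, 0 < r → Tendsto (fun n => εs n ^ r) atTop (𝓝 0) := fun r hr => by
    simpa [Real.zero_rpow hr.ne'] using hε0.rpow_const (Or.inr hr.le)
  have hlim : Tendsto (fun n => K / c * (εs n ^ (2 * H - α * (1 + 2 * H))
      + T ^ (1 - 2 * H) * εs n ^ (2 * H - 2 * α))) atTop (𝓝 0) := by
    simpa using ((hpow _ hp).add ((hpow _ hq).const_mul (T ^ (1 - 2 * H)))).const_mul (K / c)
  have hNpos : ∀ n, 0 < Ns n := fun n => by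
    have := hεpos n
    rw [hNs]; positivity
  refine squeeze_zero (fun n => ?_) (fun n => ?_) hlim
  · have := hεpos n
    have := hNpos n
    positivity
  · have he := hεpos n
    have hN := hNpos n
    have hmin : (min 1 (Ns n ^ (2 * H - 1)))⁻¹ ≤ 1 + Ns n ^ (1 - 2 * H) := by
      rw [show 1 - 2 * H = -(2 * H - 1) by ring, Real.rpow_neg hN.le]
      have : 0 < (Ns n ^ (2 * H - 1))⁻¹ := by positivity
      rcases min_choice 1 (Ns n ^ (2 * H - 1)) with h | h <;> rw [h]
      · simp only [inv_one]; linarith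
      · linarith
    have hNr : Ns n ^ (1 - 2 * H) = T ^ (1 - 2 * H) * εs n ^ (-(α * (1 - 2 * H))) := by
      rw [hNs, Real.div_rpow hT.le (by positivity), ← Real.rpow_mul he.le, Real.rpow_neg he.le]
      rfl
    calc _ = K / c * ((εs n ^ (2 * H) * ((εs n ^ α) ^ (2 * H))⁻¹ * (εs n ^ α)⁻¹)
          * (min 1 (Ns n ^ (2 * H - 1)))⁻¹) := by
          rw [mul_inv, mul_inv]; ring
      _ ≤ K / c * ((εs n ^ (2 * H) * ((εs n ^ α) ^ (2 * H))⁻¹ * (εs n ^ α)⁻¹)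
          * (1 + Ns n ^ (1 - 2 * H))) := by gcongr
      _ = _ := by
          have e1 : εs n ^ (2 * H) * ((εs n ^ α) ^ (2 * H))⁻¹ * (εs n ^ α)⁻¹
              = εs n ^ (2 * H - α * (1 + 2 * H)) := by
            rw [← Real.rpow_mul he.le, ← Real.rpow_neg he.le, ← Real.rpow_neg he.le,
              ← Real.rpow_add he, ← Real.rpow_add he]
            ring_nf
          have e2 : εs n ^ (2 * H - 2 * α)
              = εs n ^ (2 * H - α * (1 + 2 * H)) * εs n ^ (-(α * (1 - 2 * H))) := by
            rw [← Real.rpow_add he]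
            ring_nf
          rw [e1, hNr, e2]
          ring

lemma tendsto_sqrt_mul_two_sqrt_add {δ a : ℕ → ℝ} (hδ : ∀ n, 0 < δ n)
    (ha : ∀ n, 0 ≤ a n) (hδ0 : Tendsto δ atTop (𝓝 0))
    (h : Tendsto (fun n => a n / δ n) atTop (𝓝 0)) (C : ℝ) :
    Tendsto (fun n => C / √(δ n) * (2 * √(a n) + a n)) atTop (𝓝 0) := by
  have h1 : Tendsto (fun n => C * (2 * √(a n / δ n) + √(δ n) * (a n / δ n))) atTop (𝓝 0) := by
    simpa using ((h.sqrt.const_mul 2).add (hδ0.sqrt.mul h)).const_mul C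
  refine h1.congr fun n => ?_
  have hd := hδ n
  rw [Real.sqrt_div (ha n)]
  have hs : √(δ n) ≠ 0 := (Real.sqrt_pos.2 hd).ne'
  have hss : √(δ n) ^ 2 = δ n := Real.sq_sqrt hd.le
  have : a n / δ n = a n / √(δ n) ^ 2 := by rw [hss]
  rw [this]
  field_simp

lemma tendstoInMeasure_zero_of_lintegral_le {Ω : Type*} [MeasurableSpace Ω] {P : Measure Ω}
    {f : ℕ → Ω → ℝ} {r : ℕ → ℝ} (hf : ∀ n, Measurable (f n))
    (hle : ∀ n, ∫⁻ ω, ENNReal.ofReal |f n ω| ∂P ≤ ENNReal.ofReal (r n))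
    (hr : Tendsto r atTop (𝓝 0)) : TendstoInMeasure P f atTop 0 := by
  refine tendstoInMeasure_of_tendsto_eLpNorm one_ne_zero
    (fun n => (hf n).aestronglyMeasurable) aestronglyMeasurable_zero ?_
  have hr' : Tendsto (fun n => ENNReal.ofReal (r n)) atTop (𝓝 0) := by
    simpa using ENNReal.tendsto_ofReal hr
  refine tendsto_of_tendsto_of_tendsto_of_le_of_le tendsto_const_nhds hr' (fun _ => zero_le)
    fun n => ?_
  refine le_trans (le_of_eq ?_) (hle n)
  rw [sub_zero, eLpNorm_one_eq_lintegral_enorm]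
  simp only [Real.enorm_eq_ofReal_abs]

lemma sigmaHat2_CLT_of_continuous
    {Ω : Type*} [MeasureSpace Ω] [IsProbabilityMeasure (ℙ : Measure Ω)]
    {H σ T α : ℝ} (hH : H ∈ Set.Ioo (0 : ℝ) 1) (hT : 0 < T)
    (hα0 : 0 < α) (hα : α < min (H / (1 / 2 + H)) (H / (3 / 2 - H)))
    {B : ℝ → Ω → ℝ} (hB : IsTwoSidedFBM H B) (hc : ∀ ω, Continuous fun t => B t ω)
    (hInt : ∀ ε : ℝ, 0 < ε → ∀ᵐ ω : Ω, ∀ t : ℝ,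
      IntegrableOn (fun s => Real.exp (-(t - s) / ε) * |B s ω|) (Set.Iic t))
    {εs : ℕ → ℝ} {Ns : ℕ → ℕ}
    (hεpos : ∀ n, 0 < εs n) (hε0 : Tendsto εs atTop (𝓝 0))
    (hNpos : ∀ n, 0 < Ns n) (hNs : ∀ n, (Ns n : ℝ) = T / (εs n) ^ α)
    (f : BoundedContinuousFunction ℝ ℝ) :
    Tendsto
      (fun n => ∫ ω,
        f ((sigmaHat2 H σ (εs n) ((εs n) ^ α) B (Ns n) ω - σ ^ 2)
            / Real.sqrt ((εs n) ^ α)))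
      atTop
      (𝓝 (∫ x, f x ∂(gaussianReal 0 (2 * σ ^ 4 / T).toNNReal))) := by
  obtain ⟨c, hc0, hlow⟩ := exists_SigmaH_lower_bound hH.1 hH.2
  have hδ : ∀ n, 0 < εs n ^ α := fun n => Real.rpow_pos_of_pos (hεpos n) _
  have hδ0 : Tendsto (fun n => εs n ^ α) atTop (𝓝 0) := by
    simpa [Real.zero_rpow hα0.ne'] using hε0.rpow_const (Or.inr hα0.le)
  have hNr : ∀ n, (0 : ℝ) < Ns n := fun n => by exact_mod_cast hNpos n
  have hNlim : Tendsto Ns atTop atTop := by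
    rw [← tendsto_natCast_atTop_iff (R := ℝ)]
    simp only [hNs, div_eq_mul_inv]
    refine Tendsto.const_mul_atTop hT (Tendsto.inv_tendsto_nhdsGT_zero ?_)
    exact tendsto_nhdsWithin_iff.2 ⟨hδ0, Eventually.of_forall hδ⟩
  set l : ℕ → ℝ := fun n => c * (εs n ^ α) ^ (2 * H) * min 1 ((Ns n : ℝ) ^ (2 * H - 1)) with hl
  have hlpos : ∀ n, 0 < l n := fun n => by
    have := hδ n
    have := hNr n
    positivity
  choose ξ y hξ hy hlaw hy2 hest using fun n =>
    hB.exists_sigmaHat2_decomposition hc hH.1 (hεpos n) (hδ n) (hlpos n) (hInt _ (hεpos n))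
      (hlow (εs n ^ α) (Ns n) (hδ n) (hNpos n)) σ
  set K : ℝ := 4 * Real.Gamma (2 * H + 1) with hKdef
  have hK : 0 < K := mul_pos (by norm_num) (Real.Gamma_pos_of_pos (by linarith [hH.1]))
  set a : ℕ → ℝ := fun n => (l n)⁻¹ * (K * εs n ^ (2 * H)) with ha
  have hapos : ∀ n, 0 < a n := fun n =>
    mul_pos (inv_pos.2 (hlpos n)) (mul_pos hK (Real.rpow_pos_of_pos (hεpos n) _))
  have hrate : Tendsto (fun n => a n / εs n ^ α) atTop (𝓝 0) :=
    tendsto_error_rate hH.1 hH.2 hT hα hc0 hK hεpos hε0 hNs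
  have hmain := (tendstoInDistribution_sum_sq hNlim hξ hlaw).continuous_comp
    (g := fun x => σ ^ 2 / √T * x) (by fun_prop)
  set Err : ℕ → Ω → ℝ := fun n ω =>
    σ ^ 2 / (Ns n * √(εs n ^ α)) * (2 * (ξ n ω ⬝ᵥ y n ω) + y n ω ⬝ᵥ y n ω) with hErr
  have hErrm : ∀ n, Measurable (Err n) := fun n => by
    have := hξ n
    have := hy n
    simp only [hErr, dotProduct]
    fun_prop
  have hErr0 : TendstoInMeasure ℙ Err atTop 0 := by
    refine tendstoInMeasure_zero_of_lintegral_le hErrm (fun n => ?_)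
      (tendsto_sqrt_mul_two_sqrt_add hδ (fun n => (hapos n).le) hδ0 hrate (σ ^ 2))
    have hcoef : 0 ≤ σ ^ 2 / (Ns n * √(εs n ^ α)) := by positivity
    have hcross := lintegral_cross_term_le (hξ n) (hlaw n) (hapos n)
      ((hy2 n).trans_eq (by simp only [ha, hKdef]; ring_nf))
    simp only [hErr, abs_mul, abs_of_nonneg hcoef, ENNReal.ofReal_mul hcoef]
    rw [lintegral_const_mul' _ _ ENNReal.ofReal_ne_top]
    calc _ ≤ _ := mul_le_mul_right hcross _
      _ = _ := by
        rw [← ENNReal.ofReal_mul hcoef]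
        congr 1
        have := (hNr n).ne'
        field_simp
  set M : ℕ → Ω → ℝ := fun n =>
    (fun x => σ ^ 2 / √T * x) ∘ fun ω => (√(Ns n : ℝ))⁻¹ * (ξ n ω ⬝ᵥ ξ n ω - Ns n) with hM
  have hMm : ∀ n, Measurable (M n) := fun n => by
    have := hξ n
    simp only [hM, Function.comp_def, dotProduct]
    fun_prop
  have hconv := tendstoInDistribution_of_tendstoInMeasure_sub (fun n => M n + Err n) _ hmain
    (by simpa [Pi.sub_def, Pi.add_def] using hErr0)
    fun n => ((hMm n).add (hErrm n)).aemeasurable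
  have hlim := ProbabilityMeasure.tendsto_iff_forall_integral_tendsto.1 hconv.tendsto f
  simp only [ProbabilityMeasure.coe_mk] at hlim
  have hfm := f.continuous.measurable
  have hlimlaw : (gaussianReal 0 2).map ((fun x => σ ^ 2 / √T * x) ∘ id)
      = gaussianReal 0 (2 * σ ^ 4 / T).toNNReal := by
    rw [Function.comp_id, gaussianReal_map_const_mul]
    congr 1
    · simp
    · ext
      rw [Real.coe_toNNReal _ (by positivity)]
      simp only [NNReal.coe_mul, NNReal.coe_mk, NNReal.coe_ofNat, div_pow, Real.sq_sqrt hT.le]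
      ring
  rw [hlimlaw] at hlim
  refine hlim.congr fun n => ?_
  rw [integral_map (by fun_prop) hfm.aestronglyMeasurable]
  refine integral_congr_ae ?_
  filter_upwards [hest n] with ω hω
  rw [hω]
  congr 1
  simp only [hM, hErr, Pi.add_apply, Function.comp]
  have hTn : T = Ns n * εs n ^ α := by
    rw [hNs, div_mul_cancel₀ _ (hδ n).ne']
  have hsT : √T = √(Ns n : ℝ) * √(εs n ^ α) := by
    rw [hTn, Real.sqrt_mul (hNr n).le]
  have hsN : √(Ns n : ℝ) ^ 2 = Ns n := Real.sq_sqrt (hNr n).le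
  have h1 : √(Ns n : ℝ) ≠ 0 := (Real.sqrt_pos.2 (hNr n)).ne'
  have h2 : √(εs n ^ α) ≠ 0 := (Real.sqrt_pos.2 (hδ n)).ne'
  rw [hsT]
  generalize √(Ns n : ℝ) = s at hsN h1 ⊢
  rw [← hsN]
  field_simp
  ring

/-- Asymptotic normality: under the subsampling condition `δ = ε^α` with
`0 < α < min{H/(1/2+H), H/(3/2−H)}`, the rescaled error `(σ̂²_{ε,δ} − σ²)/√δ`
converges in distribution to a centered Gaussian with variance `2σ⁴/T`
(convergence in distribution is expressed by testing against bounded continuous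
functions). -/
theorem sigmaHat2_CLT
    {Ω : Type*} [MeasureSpace Ω] [IsProbabilityMeasure (ℙ : Measure Ω)]
    (H σ T α : ℝ) (hH : H ∈ Set.Ioo (0 : ℝ) 1) (hσ : 0 < σ) (hT : 0 < T)
    (hα0 : 0 < α) (hα : α < min (H / (1 / 2 + H)) (H / (3 / 2 - H)))
    (B : ℝ → Ω → ℝ) (hB : IsTwoSidedFBM H B)
    (hInt : ∀ ε : ℝ, 0 < ε → ∀ᵐ ω : Ω, ∀ t : ℝ,
      IntegrableOn (fun s => Real.exp (-(t - s) / ε) * |B s ω|) (Set.Iic t))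
    (εs : ℕ → ℝ) (Ns : ℕ → ℕ)
    (hεpos : ∀ n, 0 < εs n) (hε0 : Tendsto εs atTop (𝓝 0))
    (hNpos : ∀ n, 0 < Ns n) (hNs : ∀ n, (Ns n : ℝ) = T / (εs n) ^ α) :
    ∀ f : BoundedContinuousFunction ℝ ℝ,
      Tendsto
        (fun n => ∫ ω,
          f ((sigmaHat2 H σ (εs n) ((εs n) ^ α) B (Ns n) ω - σ ^ 2)
              / Real.sqrt ((εs n) ^ α)))
        atTop
        (𝓝 (∫ x, f x ∂(gaussianReal 0 (2 * σ ^ 4 / T).toNNReal))) := by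
  obtain ⟨B', hB', hc', hae⟩ := hB.exists_continuous_version
  intro f
  refine (sigmaHat2_CLT_of_continuous hH hT hα0 hα hB' hc' (fun ε hε => ?_) hεpos hε0 hNpos hNs
    f).congr fun n => ?_
  · filter_upwards [hInt ε hε, hae] with ω h1 h2
    simpa only [h2] using h1
  · refine integral_congr_ae ?_
    filter_upwards [hae] with ω h
    have hV : ∀ ε δ N, incVec H σ ε δ B' N ω = incVec H σ ε δ B N ω := fun ε δ N => by
      ext k
      simp only [incVec, slowX, fracOU, h]
    simp only [sigmaHat2, hV]
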